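/- Let J > 0 and α > 0 with 0 < J·α ≤ π/2, and let 0 ≤ ω ≤ 1. Define Q_{J,α} := {(E₁,E₂) ∈ [−1,1]² : g(E₁,E₂) ≥ cos(J·α)} and the relaxed set Q^ω_{J,α} := {(1−ω)·e + ω·e′ : e ∈ Q_{J,α}, e′ ∈ [−1,1]²}. Then Q^ω_{J,α} ⊆ {(E₁,E₂) ∈ [−1,1]² : g(E₁,E₂) ≥ cos_*(J·α + 2ω·cot(J·α))}, i.e. the ω-relaxed spin-J set at angle α is contained in the exact spin-J set at angle α + 2ω·cot(J·α)/J. -/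

import Mathlib

open Real

/-- The overlap function `g(E₁,E₂) = (1/2)(√(1+E₁)√(1+E₂) + √(1-E₁)√(1-E₂))`. -/
noncomputable def gCorr (E₁ E₂ : ℝ) : ℝ :=
  (1 / 2) * (Real.sqrt (1 + E₁) * Real.sqrt (1 + E₂)
    + Real.sqrt (1 - E₁) * Real.sqrt (1 - E₂))

/-- The truncated cosine: `cos_* t = cos t` for `0 ≤ t ≤ π/2`, and `0` otherwise. -/
noncomputable def cosStar (t : ℝ) : ℝ :=
  if 0 ≤ t ∧ t ≤ Real.pi / 2 then Real.cos t else 0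

/-- Mixing with arbitrary points of the square shrinks the overlap at most by the factor `1 - ω`. -/
lemma one_sub_mul_gCorr_le {ω E₁ E₂ F₁ F₂ : ℝ} (hω0 : 0 ≤ ω) (hω1 : ω ≤ 1)
    (hF₁ : F₁ ∈ Set.Icc (-1 : ℝ) 1) (hF₂ : F₂ ∈ Set.Icc (-1 : ℝ) 1) :
    (1 - ω) * gCorr E₁ E₂ ≤ gCorr ((1 - ω) * E₁ + ω * F₁) ((1 - ω) * E₂ + ω * F₂) := by
  obtain ⟨hF₁l, hF₁u⟩ := hF₁
  obtain ⟨hF₂l, hF₂u⟩ := hF₂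
  have hω : 0 ≤ 1 - ω := sub_nonneg.2 hω1
  have key : ∀ {a b c d : ℝ}, (1 - ω) * a ≤ c → (1 - ω) * b ≤ d →
      (1 - ω) * (√a * √b) ≤ √c * √d := by
    intro a b c d hac hbd
    calc (1 - ω) * (√a * √b) = √((1 - ω) * a) * √((1 - ω) * b) := by
          rw [sqrt_mul hω, sqrt_mul hω, mul_mul_mul_comm, mul_self_sqrt hω]
      _ ≤ √c * √d := by gcongr
  have hplus := key (a := 1 + E₁) (b := 1 + E₂) (c := 1 + ((1 - ω) * E₁ + ω * F₁))
    (d := 1 + ((1 - ω) * E₂ + ω * F₂)) (by nlinarith) (by nlinarith)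
  have hminus := key (a := 1 - E₁) (b := 1 - E₂) (c := 1 - ((1 - ω) * E₁ + ω * F₁))
    (d := 1 - ((1 - ω) * E₂ + ω * F₂)) (by nlinarith) (by nlinarith)
  unfold gCorr
  linarith

lemma gCorr_nonneg (E₁ E₂ : ℝ) : 0 ≤ gCorr E₁ E₂ := by
  unfold gCorr
  positivity

lemma cos_add_le_one_sub_mul_cos {θ ω : ℝ} (hθ : 0 < θ) (hω : 0 ≤ ω)
    (hsum : θ + 2 * ω * (cos θ / sin θ) ≤ π / 2) (hθ' : θ ≤ π / 2) :
    cos (θ + 2 * ω * (cos θ / sin θ)) ≤ (1 - ω) * cos θ := by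
  have hsin : 0 < sin θ := sin_pos_of_pos_of_lt_pi hθ (by linarith [pi_pos])
  have hcos : 0 ≤ cos θ := cos_nonneg_of_neg_pi_div_two_le_of_le (by linarith) hθ'
  set x := ω * (cos θ / sin θ) with hx
  have hx0 : 0 ≤ x := by positivity
  have hxs : x * sin θ = ω * cos θ := by rw [hx]; field_simp
  rw [show θ + 2 * ω * (cos θ / sin θ) = θ + 2 * x by rw [hx]; ring] at hsum ⊢
  have hdiff : cos θ - cos (θ + 2 * x) = 2 * sin (θ + x) * sin x := by
    rw [cos_sub_cos, show (θ + (θ + 2 * x)) / 2 = θ + x by ring,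
      show (θ - (θ + 2 * x)) / 2 = -x by ring, sin_neg]
    ring
  have hmono : sin θ ≤ sin (θ + x) :=
    sin_le_sin_of_le_of_le_pi_div_two (by linarith) (by linarith) (by linarith)
  have hjordan : x / 2 ≤ sin x := by
    refine le_trans ?_ (mul_le_sin hx0 (by linarith))
    rw [div_eq_mul_inv, mul_comm]
    gcongr
    rw [le_div_iff₀ pi_pos]
    linarith [pi_le_four]
  have hprod : sin θ * (x / 2) ≤ sin (θ + x) * sin x :=
    mul_le_mul hmono hjordan (by linarith) (hsin.le.trans hmono)
  linarith

/-- The `ω`-relaxed spin-`J` quantum set at angle `α` is contained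
in the exact spin-`J` set at the enlarged angle `α + 2ω·cot(Jα)/J`. -/
theorem relaxed_quantum_set_subset (J α ω : ℝ) (hJ : 0 < J) (hα : 0 < α)
    (h1 : 0 < J * α) (h2 : J * α ≤ Real.pi / 2) (hω0 : 0 ≤ ω) (hω1 : ω ≤ 1) :
    {q : ℝ × ℝ | ∃ e ∈ {E : ℝ × ℝ | E.1 ∈ Set.Icc (-1 : ℝ) 1 ∧ E.2 ∈ Set.Icc (-1 : ℝ) 1 ∧
        gCorr E.1 E.2 ≥ Real.cos (J * α)},
      ∃ e' ∈ Set.Icc ((-1, -1) : ℝ × ℝ) ((1, 1) : ℝ × ℝ),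
        q = (1 - ω) • e + ω • e'} ⊆
      {E : ℝ × ℝ | E.1 ∈ Set.Icc (-1 : ℝ) 1 ∧ E.2 ∈ Set.Icc (-1 : ℝ) 1 ∧
        gCorr E.1 E.2 ≥ cosStar (J * α + 2 * ω * (Real.cos (J * α) / Real.sin (J * α)))} := by
  rintro q ⟨e, ⟨he₁, he₂, hg⟩, e', ⟨hl, hu⟩, rfl⟩
  have hf₁ : e'.1 ∈ Set.Icc (-1 : ℝ) 1 := ⟨hl.1, hu.1⟩
  have hf₂ : e'.2 ∈ Set.Icc (-1 : ℝ) 1 := ⟨hl.2, hu.2⟩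
  have hω : 0 ≤ 1 - ω := sub_nonneg.2 hω1
  have hconv : Convex ℝ (Set.Icc (-1 : ℝ) 1) := convex_Icc _ _
  refine ⟨hconv he₁ hf₁ hω hω0 (by ring), hconv he₂ hf₂ hω hω0 (by ring), ?_⟩
  unfold cosStar
  split_ifs with hrange
  · calc cos (J * α + 2 * ω * (cos (J * α) / sin (J * α)))
        ≤ (1 - ω) * cos (J * α) := cos_add_le_one_sub_mul_cos h1 hω0 hrange.2 h2
      _ ≤ (1 - ω) * gCorr e.1 e.2 := mul_le_mul_of_nonneg_left hg hω
      _ ≤ _ := one_sub_mul_gCorr_le hω0 hω1 hf₁ hf₂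
  · exact gCorr_nonneg _ _
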